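/- arXiv:nlin/0604052 — 5 statements merged into one kernel-verified Lean document; each statement's English description precedes it below -/
import Mathlib

section
/- If F : Λ → Λ preserves a Borel probability measure ν on Λ and is ergodic, then ν-almost every x ∈ Λ is strongly recurrent. -/
open MeasureTheory Filter Set Metric
open scoped ENNReal

noncomputable section

variable {d : ℕ} {Λ : Set (EuclideanSpace ℝ (Fin d))}

/-- The bi-infinite trajectory of `x` under the invertible map `F : Λ → Λ`. -/
def traj (F : Equiv.Perm Λ) (x : Λ) (s : ℤ) : EuclideanSpace ℝ (Fin d) :=
  ((F ^ s) x : Λ)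

/-- `F` is expansive with separation threshold `Δ`. -/
def Expansive (F : Equiv.Perm Λ) (Δ : ℝ) : Prop :=
  ∀ x x' : Λ, x ≠ x' → ∃ s : ℤ, Δ < ‖traj F x s - traj F x' s‖

/-- Separation time `s(x,x') = min{|s| : |F^s x - F^s x'| > Δ}`. -/
def sepTime (F : Equiv.Perm Λ) (Δ : ℝ) (x x' : Λ) : ℕ :=
  sInf {m : ℕ | ∃ s : ℤ, s.natAbs = m ∧ Δ < ‖traj F x s - traj F x' s‖}

/-- Separation horizon `H(α) = sup{ s(x,x') : |x - x'| ≥ α }`. -/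
def sepHorizon (F : Equiv.Perm Λ) (Δ : ℝ) (α : ℝ) : ℕ∞ :=
  ⨆ (p : Λ × Λ) (_ : α ≤ ‖(p.1 : EuclideanSpace ℝ (Fin d)) - (p.2 : EuclideanSpace ℝ (Fin d))‖),
    (sepTime F Δ p.1 p.2 : ℕ∞)

/-- `F` has finite separation horizon. -/
def FiniteSepHorizon (F : Equiv.Perm Λ) (Δ : ℝ) : Prop :=
  ∀ α : ℝ, 0 < α → sepHorizon F Δ α < ⊤

open scoped Classical in
/-- A point `x ∈ Λ` is strongly recurrent (relative to the separation threshold `Δ`). -/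
def StronglyRecurrent (F : Equiv.Perm Λ) (Δ : ℝ) (x : Λ) : Prop :=
  ∃ 𝒪 : Finset (Set (EuclideanSpace ℝ (Fin d))),
    (∀ O ∈ 𝒪, EMetric.diam O < ENNReal.ofReal (Δ / 5)) ∧
    (Λ ⊆ ⋃ O ∈ 𝒪, O) ∧
    ∀ r : ℕ, 1 ≤ r → ∀ Os : Fin r → Set (EuclideanSpace ℝ (Fin d)), (∀ t, Os t ∈ 𝒪) →
      {i : ℕ | ∀ t : Fin r, traj F x (i + (t : ℕ)) ∈ Os t}.Finite ∨
      0 < Filter.liminf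
        (fun n : ℕ => (n : ℝ)⁻¹ * ∑ i ∈ Finset.range n,
          (if ∀ t : Fin r, traj F x (i + (t : ℕ)) ∈ Os t then (1 : ℝ) else 0))
        Filter.atTop

/-- If every visit to `s` starts a block of length at most `N` in which visits to `A` have
frequency at most `1 / k`, then visits to `A ∩ s` have frequency at most `1 / k`, up to a bounded
error. -/
theorem mul_birkhoffSum_inter_le {X : Type*} (T : X → X) (A s : Set X) (k N : ℕ)
    (hs : ∀ x ∈ s, ∃ n, 1 ≤ n ∧ n ≤ N ∧ k * birkhoffSum T (A.indicator fun _ => 1) n x ≤ n)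
    (M : ℕ) (x : X) :
    k * birkhoffSum T ((A ∩ s).indicator fun _ => 1) M x ≤ M + k * N := by
  have hle : ∀ n y, birkhoffSum T ((A ∩ s).indicator fun _ => 1) n y ≤
      birkhoffSum T (A.indicator fun _ => 1) n y := fun n y =>
    Finset.sum_le_sum fun i _ => indicator_le_indicator_of_subset inter_subset_left
      (fun _ => Nat.zero_le _) _
  have hcard : ∀ n y, birkhoffSum T ((A ∩ s).indicator fun _ => 1) n y ≤ n := fun n y => by
    have h : ∀ i ∈ Finset.range n, (A ∩ s).indicator (fun _ => 1) (T^[i] y) ≤ 1 := fun i _ =>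
      indicator_le_self' (fun _ _ => Nat.zero_le _) _
    simpa [birkhoffSum] using Finset.sum_le_card_nsmul _ _ _ h
  induction M using Nat.strong_induction_on generalizing x with
  | _ M ih =>
    rcases Nat.eq_zero_or_pos M with rfl | hM
    · simp
    by_cases hx : x ∈ s
    · obtain ⟨n, hn1, hnN, hn⟩ := hs x hx
      rcases le_or_gt n M with hnM | hnM
      · obtain ⟨m, rfl⟩ := Nat.exists_eq_add_of_le hnM
        rw [birkhoffSum_add, mul_add]
        have h1 := ih m (by omega) (T^[n] x)
        have h2 := Nat.mul_le_mul_left k (hle n x)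
        omega
      · have h := Nat.mul_le_mul_left k ((hcard M x).trans (hnM.le.trans hnN))
        omega
    · obtain ⟨m, rfl⟩ : ∃ m, M = m + 1 := ⟨M - 1, by omega⟩
      rw [birkhoffSum_succ', indicator_of_notMem (fun h => hx h.2), zero_add]
      have h := ih m (by omega) (T x)
      omega

theorem measurable_birkhoffSum {X M : Type*} [MeasurableSpace X] [AddCommMonoid M]
    [MeasurableSpace M] [MeasurableAdd₂ M] {T : X → X} {f : X → M} (hT : Measurable T)
    (hf : Measurable f) (n : ℕ) : Measurable (birkhoffSum T f n) :=
  Finset.measurable_sum _ fun i _ => hf.comp (hT.iterate i)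

/-- The expected number of visits to `A` before time `n` is `n * μ A`. -/
theorem MeasureTheory.MeasurePreserving.lintegral_birkhoffSum_indicator {X : Type*}
    [MeasurableSpace X] {μ : Measure X} {T : X → X} (hT : MeasurePreserving T μ μ) {A : Set X}
    (hA : MeasurableSet A) (n : ℕ) :
    ∫⁻ x, ((birkhoffSum T (A.indicator fun _ => 1) n x : ℕ) : ℝ≥0∞) ∂μ = n * μ A := by
  have h1 : ∀ x, ((birkhoffSum T (A.indicator fun _ => 1) n x : ℕ) : ℝ≥0∞) =
      ∑ i ∈ Finset.range n, (T^[i] ⁻¹' A).indicator (fun _ => (1 : ℝ≥0∞)) x := fun x => by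
    classical
    simp [birkhoffSum, indicator_apply]
  simp_rw [h1]
  rw [lintegral_finsetSum _ fun i _ =>
    measurable_const.indicator (hT.measurable.iterate i hA)]
  simp [lintegral_indicator (hT.measurable.iterate _ hA),
    (hT.iterate _).measure_preimage hA.nullMeasurableSet]

/-- If almost every orbit has visit frequency to `A` at most `1 / k` along some initial block, then
`μ A ≤ 1 / k`. -/
theorem MeasureTheory.MeasurePreserving.mul_measure_le_one {X : Type*} [MeasurableSpace X]
    {μ : Measure X} [IsProbabilityMeasure μ] {T : X → X} (hT : MeasurePreserving T μ μ)
    {A : Set X} (hA : MeasurableSet A) (k : ℕ)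
    (h : ∀ᵐ x ∂μ, ∃ n, 1 ≤ n ∧ k * birkhoffSum T (A.indicator fun _ => 1) n x ≤ n) :
    k * μ A ≤ 1 := by
  set E : ℕ → Set X := fun N =>
    {x | ∃ n, 1 ≤ n ∧ n ≤ N ∧ k * birkhoffSum T (A.indicator fun _ => 1) n x ≤ n} with hE
  have hEm : ∀ N, MeasurableSet (E N) := fun N => by
    have hm := measurable_birkhoffSum hT.measurable
      ((measurable_const (a := (1 : ℕ))).indicator hA)
    simp only [hE, ofPred_exists, ofPred_and]
    exact .iUnion fun n => (MeasurableSet.const _).inter ((MeasurableSet.const _).inter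
      (measurableSet_le ((hm n).const_mul k) measurable_const))
  have hmono : Monotone fun N => A ∩ E N := fun N N' hNN' x hx => by
    obtain ⟨hxA, n, h1, h2, h3⟩ := hx
    exact ⟨hxA, n, h1, h2.trans hNN', h3⟩
  have hU : μ (⋃ N, A ∩ E N) = μ A := by
    refine measure_congr ?_
    filter_upwards [h] with x hx
    obtain ⟨n, hn1, hn⟩ := hx
    refine propext ⟨fun hx' => ?_, fun hxA => ?_⟩
    · obtain ⟨N, hN⟩ := mem_iUnion.1 hx'
      exact hN.1
    · exact mem_iUnion.2 ⟨n, hxA, n, hn1, le_rfl, hn⟩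
  have key : ∀ N, k * μ (A ∩ E N) ≤ 1 := fun N => by
    have hM : ∀ M : ℕ, 1 ≤ M → k * μ (A ∩ E N) ≤ 1 + (k * N : ℕ) / (M : ℝ≥0∞) := fun M hM => by
      have h1 : (k : ℝ≥0∞) * (M * μ (A ∩ E N)) ≤ M + (k * N : ℕ) := by
        rw [← hT.lintegral_birkhoffSum_indicator (hA.inter (hEm N)),
          ← lintegral_const_mul' _ _ (ENNReal.natCast_ne_top k)]
        calc _ ≤ ∫⁻ _, ((M + k * N : ℕ) : ℝ≥0∞) ∂μ := lintegral_mono fun x => by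
              rw [← Nat.cast_mul, Nat.cast_le]
              exact mul_birkhoffSum_inter_le T A (E N) k N (fun _ hx => hx) M x
          _ = _ := by simp
      have hM0 : (M : ℝ≥0∞) ≠ 0 := by exact_mod_cast (by omega : M ≠ 0)
      rw [← ENNReal.div_self hM0 (ENNReal.natCast_ne_top M), ← ENNReal.add_div,
        ENNReal.le_div_iff_mul_le (.inl hM0) (.inl (ENNReal.natCast_ne_top M))]
      calc _ = (k : ℝ≥0∞) * (M * μ (A ∩ E N)) := by ring
        _ ≤ _ := h1
    have ht : Tendsto (fun M : ℕ => 1 + (k * N : ℕ) / (M : ℝ≥0∞)) atTop (nhds (1 + 0)) :=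
      tendsto_const_nhds.add
        (ENNReal.Tendsto.const_div ENNReal.tendsto_nat_nhds_top (.inr (ENNReal.natCast_ne_top _))
          |>.trans (by simp))
    rw [add_zero] at ht
    exact ge_of_tendsto ht ((eventually_ge_atTop 1).mono hM)
  rw [← hU, hmono.measure_iUnion, ENNReal.mul_iSup]
  exact iSup_le key

/-- Almost every orbit of an ergodic map visits a set of positive measure with positive lower
frequency. -/
theorem Ergodic.ae_exists_le_mul_birkhoffSum {X : Type*} [MeasurableSpace X] {μ : Measure X}
    [IsProbabilityMeasure μ] {T : X → X} (hT : Ergodic T μ) {A : Set X} (hA : MeasurableSet A)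
    (hμ : μ A ≠ 0) :
    ∀ᵐ x ∂μ, ∃ k : ℕ, ∀ᶠ n in atTop, n ≤ k * birkhoffSum T (A.indicator fun _ => 1) n x := by
  set G : Set X :=
    {x | ∃ k n₀ : ℕ, ∀ n, n₀ ≤ n → n ≤ k * birkhoffSum T (A.indicator fun _ => 1) n x} with hG
  have hGm : MeasurableSet G := by
    have hm := measurable_birkhoffSum hT.measurable
      ((measurable_const (a := (1 : ℕ))).indicator hA)
    simp only [hG, ofPred_exists, ofPred_forall]
    exact .iUnion fun k => .iUnion fun n₀ => .iInter fun n => .iInter fun _ =>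
      measurableSet_le measurable_const ((hm n).const_mul k)
  have hinv : T ⁻¹' G = G := by
    ext x
    have hsucc := fun n => birkhoffSum_succ' T (A.indicator fun _ => 1) n x
    have hx1 : A.indicator (fun _ => 1) x ≤ 1 :=
      indicator_le_self' (fun _ _ => Nat.zero_le _) _
    constructor
    · rintro ⟨k, n₀, h⟩
      refine ⟨2 * k, n₀ + 2, fun n hn => ?_⟩
      obtain ⟨m, rfl⟩ : ∃ m, n = m + 1 := ⟨n - 1, by omega⟩
      have := h m (by omega)
      rw [hsucc m]
      nlinarith [Nat.zero_le (k * A.indicator (fun _ => 1) x)]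
    · rintro ⟨k, n₀, h⟩
      refine ⟨2 * k, n₀ + 2 * k, fun n hn => ?_⟩
      have h1 := h (n + 1) (by omega)
      rw [hsucc n] at h1
      nlinarith [Nat.mul_le_mul_left k hx1]
  rcases hT.toPreErgodic.ae_mem_or_ae_notMem hGm hinv with h | h
  · filter_upwards [h] with x hx
    obtain ⟨k, n₀, hk⟩ := hx
    exact ⟨k, eventually_atTop.2 ⟨n₀, hk⟩⟩
  · exfalso
    obtain ⟨k, hk⟩ := ENNReal.exists_nat_mul_gt hμ ENNReal.one_ne_top
    refine hk.not_ge (hT.toMeasurePreserving.mul_measure_le_one hA k ?_)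
    filter_upwards [h] with x hx
    by_contra! hcon
    exact hx ⟨k, 1, fun n hn => (hcon n hn).le⟩

/-- Almost every orbit of an ergodic map visits a given measurable set either finitely often or
with positive lower frequency. -/
theorem Ergodic.ae_finite_or_liminf_pos {X : Type*} [MeasurableSpace X] {μ : Measure X}
    [IsProbabilityMeasure μ] {T : X → X} (hT : Ergodic T μ) {A : Set X} (hA : MeasurableSet A) :
    ∀ᵐ x ∂μ, {i : ℕ | T^[i] x ∈ A}.Finite ∨
      0 < liminf (fun n : ℕ => (n : ℝ)⁻¹ *
        ∑ i ∈ Finset.range n, A.indicator (fun _ => (1 : ℝ)) (T^[i] x)) atTop := by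
  by_cases hμ : μ A = 0
  · have h : ∀ᵐ x ∂μ, ∀ i : ℕ, T^[i] x ∉ A := ae_all_iff.2 fun i => by
      rw [← (hT.toMeasurePreserving.iterate i).measure_preimage hA.nullMeasurableSet] at hμ
      exact measure_eq_zero_iff_ae_notMem.1 hμ
    filter_upwards [h] with x hx
    exact .inl (by simp [hx])
  · filter_upwards [hT.ae_exists_le_mul_birkhoffSum hA hμ] with x ⟨k, hk⟩
    right
    have hsum : ∀ n, ∑ i ∈ Finset.range n, A.indicator (fun _ => (1 : ℝ)) (T^[i] x) =
        (birkhoffSum T (A.indicator fun _ => 1) n x : ℕ) := fun n => by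
      classical
      simp [birkhoffSum, indicator_apply]
    have hk0 : 0 < k := by
      obtain ⟨n, hn, hn1⟩ := (hk.and (eventually_ge_atTop 1)).exists
      exact Nat.pos_of_ne_zero fun h => by simp [h] at hn; omega
    have hub : ∀ n : ℕ, (n : ℝ)⁻¹ *
        ∑ i ∈ Finset.range n, A.indicator (fun _ => (1 : ℝ)) (T^[i] x) ≤ 1 := fun n => by
      have h1 : ∑ i ∈ Finset.range n, A.indicator (fun _ => (1 : ℝ)) (T^[i] x) ≤ n := by
        have h : ∀ i ∈ Finset.range n, A.indicator (fun _ => (1 : ℝ)) (T^[i] x) ≤ 1 := fun i _ =>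
          indicator_le_self' (fun _ _ => zero_le_one) _
        simpa using Finset.sum_le_card_nsmul _ _ _ h
      calc _ ≤ (n : ℝ)⁻¹ * n := by gcongr
        _ ≤ 1 := inv_mul_le_one
    refine lt_of_lt_of_le (inv_pos.2 (Nat.cast_pos.2 hk0) : (0 : ℝ) < (k : ℝ)⁻¹)
      (le_liminf_of_le (isCoboundedUnder_ge_of_le _ hub) ?_)
    filter_upwards [hk, eventually_ge_atTop 1] with n hn hn1
    have hk0' : (0 : ℝ) < k := Nat.cast_pos.2 hk0
    have hn0' : (0 : ℝ) < n := Nat.cast_pos.2 hn1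
    rw [hsum, inv_mul_eq_div, le_div_iff₀ hn0', inv_mul_le_iff₀ hk0']
    exact_mod_cast hn

/-- A compact set has finite covers by balls of arbitrarily small diameter. -/
theorem IsCompact.exists_finset_cover_ediam_lt {E : Type*} [PseudoMetricSpace E] {K : Set E}
    (hK : IsCompact K) {ε : ℝ} (hε : 0 < ε) :
    ∃ 𝒪 : Finset (Set E), (∀ O ∈ 𝒪, IsOpen O) ∧
      (∀ O ∈ 𝒪, Metric.ediam O < ENNReal.ofReal ε) ∧ K ⊆ ⋃ O ∈ 𝒪, O := by
  classical
  obtain ⟨t, -, ht, hcov⟩ := hK.finite_cover_balls (e := ε / 3) (by positivity)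
  refine ⟨ht.toFinset.image fun y => ball y (ε / 3), ?_, ?_, ?_⟩
  · simp +contextual [isOpen_ball]
  · simp only [Finset.mem_image, Finite.mem_toFinset, forall_exists_index, and_imp,
      forall_apply_eq_imp_iff₂]
    intro y _
    rw [← eball_ofReal]
    refine ediam_eball_le.trans_lt ?_
    rw [show (2 : ℝ≥0∞) = ENNReal.ofReal 2 by simp, ← ENNReal.ofReal_mul zero_le_two]
    exact (ENNReal.ofReal_lt_ofReal_iff hε).2 (by linarith)
  · simpa using hcov

/-- For an ergodic measure-preserving `F`, `ν`-almost every point is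
strongly recurrent. -/
theorem stmt_3 (hΛ : IsCompact Λ) (F : Equiv.Perm Λ) (Δ : ℝ) (hΔ : 0 < Δ)
    (hexp : Expansive F Δ)
    (ν : Measure Λ) [IsProbabilityMeasure ν] (herg : Ergodic (F : Λ → Λ) ν) :
    ∀ᵐ x ∂ν, StronglyRecurrent F Δ x := by
  classical
  obtain ⟨𝒪, hopen, hdiam, hcov⟩ := hΛ.exists_finset_cover_ediam_lt (by positivity : 0 < Δ / 5)
  let C (r : ℕ) (Os : Fin r → 𝒪) : Set Λ := {x | ∀ t : Fin r, (F^[t] x : Λ).1 ∈ (Os t).1}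
  have hC : ∀ r Os, MeasurableSet (C r Os) := fun r Os => by
    simp only [C, ofPred_forall]
    exact .iInter fun t => (measurable_subtype_coe.comp (herg.measurable.iterate t))
      (hopen _ (Os t).2).measurableSet
  have hmain : ∀ᵐ x ∂ν, ∀ (r : ℕ) (Os : Fin r → 𝒪), {i : ℕ | F^[i] x ∈ C r Os}.Finite ∨
      0 < liminf (fun n : ℕ => (n : ℝ)⁻¹ *
        ∑ i ∈ Finset.range n, (C r Os).indicator (fun _ => (1 : ℝ)) (F^[i] x)) atTop :=
    ae_all_iff.2 fun r => ae_all_iff.2 fun Os => herg.ae_finite_or_liminf_pos (hC r Os)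
  filter_upwards [hmain] with x hx
  refine ⟨𝒪, hdiam, hcov, fun r _ Os hOs => ?_⟩
  have htraj : ∀ i t : ℕ, traj F x (i + t) = (F^[t] (F^[i] x) : Λ).1 := fun i t => by
    rw [traj, ← Nat.cast_add, zpow_natCast, add_comm i t, ← Function.iterate_add_apply,
      Equiv.Perm.iterate_eq_pow]
  have := hx r fun t => ⟨Os t, hOs t⟩
  simpa only [htraj, C, indicator_apply, mem_ofPred_eq] using this

end
end

section
/- If H(Δ/5) ≤ k < n/2 and k ≤ l ≤ n − k, then U_n(l,k) := Σ_{j ∈ A_n(l,k)} ε_j = Σ_{j=k}^{n−k} ε_j · I{ |x_l − x_j| ≤ Δ/5 } · Π_{1 ≤ |s| ≤ k} I{ |y_{l+s} − y_{j+s}| ≤ 3Δ/5 }. -/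
open MeasureTheory Filter Set Metric
open scoped ENNReal

noncomputable section

variable {d : ℕ} {Λ : Set (EuclideanSpace ℝ (Fin d))}

/-- `H⁻¹(k) = inf{ α > 0 : H(α) ≤ k }`. -/
def sepHorizonInv (F : Equiv.Perm Λ) (Δ : ℝ) (k : ℕ) : ℝ :=
  sInf {α : ℝ | 0 < α ∧ sepHorizon F Δ α ≤ (k : ℕ∞)}

open scoped Classical in
/-- The index set `A_n(l,k) = { j : |y_{j+r} - y_{l+r}| ≤ 3Δ/5 for all |r| ≤ k }`. -/
def Aset (Δ : ℝ) (y : ℕ → EuclideanSpace ℝ (Fin d)) (n l k : ℕ) : Finset ℕ :=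
  (Finset.Icc k (n - k)).filter fun j =>
    ∀ r ∈ Finset.Icc (-(k : ℤ)) (k : ℤ),
      ‖y ((j : ℤ) + r).toNat - y ((l : ℤ) + r).toNat‖ ≤ 3 * Δ / 5

/-- Smoothing Algorithm D estimate `x̂_{l,n}`. -/
def xhat (Δ : ℝ) (y : ℕ → EuclideanSpace ℝ (Fin d)) (n l k : ℕ) :
    EuclideanSpace ℝ (Fin d) :=
  ((Aset Δ y n l k).card : ℝ)⁻¹ • ∑ j ∈ Aset Δ y n l k, y j

lemma traj_zpow_apply (F : Equiv.Perm Λ) (x : Λ) (i s : ℤ) :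
    traj F ((F ^ i) x) s = traj F x (i + s) := by
  simp [traj, add_comm i s, zpow_add]

/-- Points at distance at least `α` separate within the separation horizon `H(α)`. -/
lemma Expansive.exists_separated {F : Equiv.Perm Λ} {Δ α : ℝ} (hexp : Expansive F Δ)
    {k : ℕ} (hα : 0 < α) (hH : sepHorizon F Δ α ≤ (k : ℕ∞)) {p q : Λ}
    (hpq : α ≤ ‖(p : EuclideanSpace ℝ (Fin d)) - q‖) :
    ∃ s ∈ Finset.Icc (-(k : ℤ)) (k : ℤ), Δ < ‖traj F p s - traj F q s‖ := by
  have hne : p ≠ q := by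
    rintro rfl
    simp only [sub_self, norm_zero] at hpq
    linarith
  obtain ⟨s₀, hs₀⟩ := hexp p q hne
  obtain ⟨s, hs, hsep⟩ : sepTime F Δ p q ∈
      {m : ℕ | ∃ s : ℤ, s.natAbs = m ∧ Δ < ‖traj F p s - traj F q s‖} :=
    Nat.sInf_mem ⟨s₀.natAbs, s₀, rfl, hs₀⟩
  have hle : (sepTime F Δ p q : ℕ∞) ≤ k :=
    (le_iSup₂_of_le (f := fun (p : Λ × Λ) (_ : α ≤ ‖(p.1 : EuclideanSpace ℝ (Fin d)) - p.2‖) =>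
      (sepTime F Δ p.1 p.2 : ℕ∞)) (p, q) hpq le_rfl).trans hH
  have hle' : sepTime F Δ p q ≤ k := by exact_mod_cast hle
  refine ⟨s, ?_, hsep⟩
  rw [Finset.mem_Icc]
  omega

/-- If two observation windows of half-width `k ≥ H(α)` match up to `δ`, the noise is bounded by
`η`, and `δ + 2 * η ≤ Δ`, then the central states are within `α` of each other. -/
lemma Expansive.norm_traj_sub_le_of_window {F : Equiv.Perm Λ} {Δ α δ η : ℝ}
    (hexp : Expansive F Δ) {k : ℕ} (hα : 0 < α) (hH : sepHorizon F Δ α ≤ (k : ℕ∞))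
    {ε : ℕ → EuclideanSpace ℝ (Fin d)} (hbdd : ∀ i, ‖ε i‖ ≤ η) (hδ : δ + 2 * η ≤ Δ)
    {x : Λ} {y : ℕ → EuclideanSpace ℝ (Fin d)} (hy : ∀ i, y i = traj F x i + ε i)
    {l j : ℕ} (hl : k ≤ l) (hj : k ≤ j)
    (hwin : ∀ r ∈ Finset.Icc (-(k : ℤ)) (k : ℤ),
      ‖y ((l : ℤ) + r).toNat - y ((j : ℤ) + r).toNat‖ ≤ δ) :
    ‖traj F x l - traj F x j‖ ≤ α := by
  by_contra! hlt
  obtain ⟨s, hs, hsep⟩ := hexp.exists_separated hα hH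
    (p := (F ^ (l : ℤ)) x) (q := (F ^ (j : ℤ)) x) hlt.le
  rw [traj_zpow_apply, traj_zpow_apply] at hsep
  have hw := hwin s hs
  rw [Finset.mem_Icc] at hs
  rw [hy, hy, Int.toNat_of_nonneg (by omega), Int.toNat_of_nonneg (by omega)] at hw
  set a := traj F x (l + s)
  set b := traj F x (j + s)
  set u := ε ((l : ℤ) + s).toNat
  set v := ε ((j : ℤ) + s).toNat
  have hu' : ‖u‖ ≤ η := hbdd _
  have hv' : ‖v‖ ≤ η := hbdd _
  have key : ‖a - b‖ ≤ ‖a + u - (b + v)‖ + ‖v‖ + ‖u‖ := by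
    calc ‖a - b‖ = ‖(a + u - (b + v)) + v - u‖ := by congr 1; abel
      _ ≤ ‖(a + u - (b + v)) + v‖ + ‖u‖ := norm_sub_le _ _
      _ ≤ _ := by gcongr; exact norm_add_le _ _
  linarith

open scoped Classical in
/-- Representation of `U_n(l,k) = Σ_{j ∈ A_n(l,k)} ε_j`. -/
theorem stmt_7 (hΛ : IsCompact Λ) (F : Equiv.Perm Λ) (Δ : ℝ) (hΔ : 0 < Δ)
    (hexp : Expansive F Δ) (hfin : FiniteSepHorizon F Δ)
    (ε : ℕ → EuclideanSpace ℝ (Fin d)) (hbdd : ∀ i, ‖ε i‖ ≤ Δ / 5)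
    (x : Λ) (y : ℕ → EuclideanSpace ℝ (Fin d))
    (hy : ∀ i, y i = traj F x i + ε i)
    (n l k : ℕ) (hH : sepHorizon F Δ (Δ / 5) ≤ (k : ℕ∞)) (hkn : 2 * k < n)
    (hlk : k ≤ l) (hln : l ≤ n - k) :
    ∑ j ∈ Aset Δ y n l k, ε j =
      ∑ j ∈ Finset.Icc k (n - k),
        if ‖traj F x l - traj F x j‖ ≤ Δ / 5 ∧
            ∀ s ∈ Finset.Icc (-(k : ℤ)) (k : ℤ), s ≠ 0 →
              ‖y ((l : ℤ) + s).toNat - y ((j : ℤ) + s).toNat‖ ≤ 3 * Δ / 5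
        then ε j else 0 := by
  rw [Aset, Finset.sum_filter]
  refine Finset.sum_congr rfl fun j hj => if_congr ?_ rfl rfl
  have hkj : k ≤ j := (Finset.mem_Icc.mp hj).1
  simp_rw [norm_sub_rev (y ((j : ℤ) + _).toNat)]
  constructor
  · intro h
    exact ⟨hexp.norm_traj_sub_le_of_window (by positivity) hH hbdd (by linarith) hy hlk hkj h,
      fun s hs _ => h s hs⟩
  · rintro ⟨h₀, h⟩ r hr
    rcases eq_or_ne r 0 with rfl | hr₀
    · rw [add_zero, add_zero, Int.toNat_natCast, Int.toNat_natCast, hy, hy, add_sub_add_comm]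
      linarith [norm_add_le (traj F x l - traj F x j) (ε l - ε j), norm_sub_le (ε l) (ε j),
        hbdd l, hbdd j]
    · exact h r hr hr₀

end
end

section
/- If the window widths satisfy k = k_n = o(log n), then for every ε > 0, n^{-1} Σ_{j=0}^{n} I{ |A_n(j,k)| ≤ n^{1−ε} } → 0 as n → ∞. -/
open MeasureTheory Filter Set Metric
open scoped ENNReal

noncomputable section

variable {d : ℕ} {Λ : Set (EuclideanSpace ℝ (Fin d))}

/-- A compact set splits into finitely many pieces of diameter at most `δ`. -/
theorem exists_finite_coding (hΛ : IsCompact Λ) {δ : ℝ} (hδ : 0 < δ) :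
    ∃ (N : ℕ) (c : Λ → Fin N), ∀ a b, c a = c b →
      ‖(a : EuclideanSpace ℝ (Fin d)) - b‖ ≤ δ := by
  obtain ⟨t, ht, hcov⟩ := Metric.totallyBounded_iff.1 hΛ.totallyBounded (δ / 2) (half_pos hδ)
  have hmem : ∀ a : Λ, ∃ p : t, dist (a : EuclideanSpace ℝ (Fin d)) p < δ / 2 := by
    intro a
    obtain ⟨p, hp, hap⟩ := mem_iUnion₂.1 (hcov a.2)
    exact ⟨⟨p, hp⟩, hap⟩
  choose c hc using hmem
  have := ht.fintype
  refine ⟨Fintype.card t, fun a => Fintype.equivFin t (c a), fun a b hab => ?_⟩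
  have hab' : c a = c b := (Fintype.equivFin t).injective hab
  have h₁ := hc a
  have h₂ := hc b
  rw [← hab'] at h₂
  rw [← dist_eq_norm]
  linarith [dist_triangle_right (a : EuclideanSpace ℝ (Fin d)) b (c a)]

/-- The sequence of pieces visited by the trajectory of `x` in the window of radius `k` about `j`,
with negative times truncated to `0`. -/
def windowCode (F : Equiv.Perm Λ) (x : Λ) {N : ℕ} (c : Λ → Fin N) (k j : ℕ) :
    Fin (2 * k + 1) → Fin N :=
  fun i => c ((F ^ ((((j : ℤ) + ((i : ℤ) - k)).toNat : ℕ) : ℤ)) x)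

theorem mem_Aset_of_windowCode_eq {F : Equiv.Perm Λ} {Δ : ℝ}
    {ε : ℕ → EuclideanSpace ℝ (Fin d)} (hbdd : ∀ i, ‖ε i‖ ≤ Δ / 5)
    {x : Λ} {y : ℕ → EuclideanSpace ℝ (Fin d)} (hy : ∀ i, y i = traj F x i + ε i)
    {N : ℕ} {c : Λ → Fin N}
    (hc : ∀ a b, c a = c b → ‖(a : EuclideanSpace ℝ (Fin d)) - b‖ ≤ Δ / 5)
    {n k j l : ℕ} (hl : l ∈ Finset.Icc k (n - k))
    (hlj : windowCode F x c k l = windowCode F x c k j) : l ∈ Aset Δ y n j k := by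
  refine Finset.mem_filter.2 ⟨hl, fun r hr => ?_⟩
  rw [Finset.mem_Icc] at hr
  have hcode := congrFun hlj ⟨(r + k).toNat, by omega⟩
  have hr' : (((r + k).toNat : ℕ) : ℤ) - k = r := by omega
  simp only [windowCode, hr'] at hcode
  have htraj := hc _ _ hcode
  rw [hy, hy]
  set p := ((l : ℤ) + r).toNat
  set q := ((j : ℤ) + r).toNat
  calc ‖traj F x p + ε p - (traj F x q + ε q)‖
      = ‖(traj F x p - traj F x q) + (ε p - ε q)‖ := by congr 1; abel
    _ ≤ ‖traj F x p - traj F x q‖ + (‖ε p‖ + ‖ε q‖) :=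
        (norm_add_le _ _).trans (add_le_add_right (norm_sub_le _ _) _)
    _ ≤ Δ / 5 + (Δ / 5 + Δ / 5) := add_le_add htraj (add_le_add (hbdd p) (hbdd q))
    _ = 3 * Δ / 5 := by ring

open scoped Classical in
/-- At most `2k` indices have a window reaching outside `[0, n]`, and at most `T` of the others
share a given code if the set of each of them has at most `T` elements. -/
theorem card_filter_card_Aset_le {F : Equiv.Perm Λ} {Δ : ℝ}
    {ε : ℕ → EuclideanSpace ℝ (Fin d)} (hbdd : ∀ i, ‖ε i‖ ≤ Δ / 5)
    {x : Λ} {y : ℕ → EuclideanSpace ℝ (Fin d)} (hy : ∀ i, y i = traj F x i + ε i)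
    {N : ℕ} {c : Λ → Fin N}
    (hc : ∀ a b, c a = c b → ‖(a : EuclideanSpace ℝ (Fin d)) - b‖ ≤ Δ / 5) (n k T : ℕ) :
    ((Finset.range (n + 1)).filter fun j => (Aset Δ y n j k).card ≤ T).card
      ≤ 2 * k + T * N ^ (2 * k + 1) := by
  set G := (Finset.Icc k (n - k)).filter fun j => (Aset Δ y n j k).card ≤ T
  have hsub : ((Finset.range (n + 1)).filter fun j => (Aset Δ y n j k).card ≤ T)
      ⊆ (Finset.range k ∪ Finset.Ioc (n - k) n) ∪ G := by
    intro j hj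
    simp only [G, Finset.mem_filter, Finset.mem_range, Finset.mem_union, Finset.mem_Ioc,
      Finset.mem_Icc] at hj ⊢
    obtain ⟨hj₁, hj₂⟩ := hj
    by_cases hjk : k ≤ j ∧ j ≤ n - k
    · exact Or.inr ⟨hjk, hj₂⟩
    · left; omega
  have hG : G.card ≤ T * (Finset.univ : Finset (Fin (2 * k + 1) → Fin N)).card := by
    refine Finset.card_le_mul_card_image_of_maps_to (f := windowCode F x c k)
      (fun _ _ => Finset.mem_univ _) T fun b _ => ?_
    rcases (G.filter fun j => windowCode F x c k j = b).eq_empty_or_nonempty with h | ⟨j, hj⟩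
    · simp [h]
    · obtain ⟨hjG, hjb⟩ := Finset.mem_filter.1 hj
      refine (Finset.card_le_card fun l hl => ?_).trans (Finset.mem_filter.1 hjG).2
      obtain ⟨hlG, hlb⟩ := Finset.mem_filter.1 hl
      exact mem_Aset_of_windowCode_eq hbdd hy hc (Finset.mem_filter.1 hlG).1 (hlb.trans hjb.symm)
  have hcard : (Finset.univ : Finset (Fin (2 * k + 1) → Fin N)).card = N ^ (2 * k + 1) := by
    simp
  rw [hcard] at hG
  have h₁ := Finset.card_le_card hsub
  have h₂ := Finset.card_union_le (Finset.range k ∪ Finset.Ioc (n - k) n) G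
  have h₃ := Finset.card_union_le (Finset.range k) (Finset.Ioc (n - k) n)
  rw [Finset.card_range, Nat.card_Ioc] at h₃
  omega

/-- If `k n = o(log n)` then `M ^ (2 * k n + 1)` is eventually below any positive power of `n`,
up to a constant factor. -/
theorem eventually_pow_le_mul_rpow {k : ℕ → ℕ}
    (hk : Tendsto (fun n : ℕ => (k n : ℝ) / Real.log n) atTop (nhds 0))
    {M : ℝ} (hM : 1 ≤ M) {δ : ℝ} (hδ : 0 < δ) :
    ∀ᶠ n : ℕ in atTop, M ^ (2 * k n + 1) ≤ M * (n : ℝ) ^ δ := by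
  have hlogM : 0 ≤ Real.log M := Real.log_nonneg hM
  have hη : 0 < δ / (2 * (Real.log M + 1)) := by positivity
  filter_upwards [hk.eventually_lt_const hη, eventually_ge_atTop 2] with n hn hn₂
  have hn' : (1 : ℝ) < n := by exact_mod_cast hn₂
  have hlog : 0 < Real.log n := Real.log_pos hn'
  have hM₀ : 0 < M := by linarith
  rw [div_lt_div_iff₀ hlog (by positivity)] at hn
  have hexp : M ^ (2 * k n) ≤ (n : ℝ) ^ δ := by
    rw [← Real.rpow_natCast, Real.rpow_def_of_pos hM₀, Real.rpow_def_of_pos (by linarith)]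
    refine Real.exp_le_exp.2 ?_
    push_cast
    nlinarith [(Nat.cast_nonneg (k n) : (0 : ℝ) ≤ k n)]
  rw [pow_succ']
  gcongr

/-- The number of indices bounded in `card_filter_card_Aset_le` is `o(n)`. -/
theorem tendsto_inv_mul_window_bound {k : ℕ → ℕ}
    (hk : Tendsto (fun n : ℕ => (k n : ℝ) / Real.log n) atTop (nhds 0))
    {M : ℝ} (hM : 1 ≤ M) {e : ℝ} (he : 0 < e) :
    Tendsto (fun n : ℕ => (n : ℝ)⁻¹ * (2 * k n + (n : ℝ) ^ (1 - e) * M ^ (2 * k n + 1)))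
      atTop (nhds 0) := by
  have hlog : Tendsto (fun n : ℕ => Real.log n / n) atTop (nhds 0) :=
    (Real.isLittleO_log_id_atTop.tendsto_div_nhds_zero).comp tendsto_natCast_atTop_atTop
  have hpow : Tendsto (fun n : ℕ => (n : ℝ) ^ (-(e / 2))) atTop (nhds 0) :=
    (tendsto_rpow_neg_atTop (half_pos he)).comp tendsto_natCast_atTop_atTop
  have hlim := ((hk.mul hlog).const_mul 2).add (hpow.const_mul M)
  simp only [mul_zero, add_zero] at hlim
  refine squeeze_zero' (Eventually.of_forall fun n => by positivity) ?_ hlim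
  filter_upwards [eventually_pow_le_mul_rpow hk hM (half_pos he), eventually_ge_atTop 2]
    with n hn hn₂
  have hn' : (1 : ℝ) < n := by exact_mod_cast hn₂
  have hn₀ : (0 : ℝ) < n := by linarith
  have hlog₀ : 0 < Real.log n := Real.log_pos hn'
  have hexp : (n : ℝ)⁻¹ * ((n : ℝ) ^ (1 - e) * (n : ℝ) ^ (e / 2)) = (n : ℝ) ^ (-(e / 2)) := by
    rw [← Real.rpow_neg_one, ← Real.rpow_add hn₀, ← Real.rpow_add hn₀]
    congr 1; ring
  calc (n : ℝ)⁻¹ * (2 * k n + (n : ℝ) ^ (1 - e) * M ^ (2 * k n + 1))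
      ≤ (n : ℝ)⁻¹ * (2 * k n + (n : ℝ) ^ (1 - e) * (M * (n : ℝ) ^ (e / 2))) := by gcongr
    _ = 2 * (k n / Real.log n * (Real.log n / n)) + M * (n : ℝ) ^ (-(e / 2)) := by
        rw [← hexp]; field_simp

open scoped Classical in
/-- If `k_n = o(log n)` then the fraction of indices `j ≤ n` with
`|A_n(j,k)| ≤ n^{1-ε}` tends to zero. -/
theorem stmt_11 (hΛ : IsCompact Λ) (F : Equiv.Perm Λ) (Δ : ℝ) (hΔ : 0 < Δ)
    (hexp : Expansive F Δ)
    (ε : ℕ → EuclideanSpace ℝ (Fin d)) (hbdd : ∀ i, ‖ε i‖ ≤ Δ / 5)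
    (x : Λ) (y : ℕ → EuclideanSpace ℝ (Fin d))
    (hy : ∀ i, y i = traj F x i + ε i)
    (k : ℕ → ℕ) (hk : Tendsto (fun n : ℕ => (k n : ℝ) / Real.log n) atTop (nhds 0))
    (e : ℝ) (he : 0 < e) :
    Tendsto
      (fun n : ℕ => (n : ℝ)⁻¹ * ∑ j ∈ Finset.range (n + 1),
        if ((Aset Δ y n j (k n)).card : ℝ) ≤ (n : ℝ) ^ ((1 : ℝ) - e) then (1 : ℝ) else 0)
      atTop (nhds 0) := by
  obtain ⟨N, c, hc⟩ := exists_finite_coding hΛ (show 0 < Δ / 5 by linarith)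
  have hN : 1 ≤ (N : ℝ) := by exact_mod_cast (Fin.pos (c x))
  refine squeeze_zero (fun n => ?_) (fun n => ?_) (tendsto_inv_mul_window_bound hk hN he)
  · exact mul_nonneg (by positivity) (Finset.sum_nonneg fun j _ => by split_ifs <;> norm_num)
  · refine mul_le_mul_of_nonneg_left ?_ (by positivity)
    have hT : 0 ≤ (n : ℝ) ^ (1 - e) := by positivity
    have hcard := card_filter_card_Aset_le hbdd hy hc n (k n) ⌊(n : ℝ) ^ (1 - e)⌋₊
    simp only [Nat.le_floor_iff hT] at hcard
    rw [Finset.sum_boole]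
    refine (Nat.cast_le.2 hcard).trans ?_
    push_cast
    gcongr
    exact Nat.floor_le hT

end
end

section
/- If the initial state x is strongly recurrent, then min{ k_{j,n} : log n ≤ j ≤ n − log n } → ∞ as n → ∞. -/
open MeasureTheory Filter Set Metric
open scoped ENNReal

noncomputable section

variable {d : ℕ} {Λ : Set (EuclideanSpace ℝ (Fin d))}

/-- Adaptive window width `k_{l,n}`. -/
def kvar (Δ : ℝ) (y : ℕ → EuclideanSpace ℝ (Fin d)) (n l : ℕ) : ℕ :=
  sSup {k : ℕ | 1 ≤ k ∧ (k : ℝ) ≤ Real.log n ∧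
    (n : ℝ) / Real.log n ≤ ((Aset Δ y n l k).card : ℝ)}

/-- Two orbit segments whose positions share small sets give `ε`-perturbed observations
within `3Δ/5`. -/
theorem norm_observation_sub_le {F : Equiv.Perm Λ} {Δ : ℝ} (hΔ : 0 < Δ)
    {ε : ℕ → EuclideanSpace ℝ (Fin d)} (hbdd : ∀ i, ‖ε i‖ ≤ Δ / 5) {x : Λ}
    {y : ℕ → EuclideanSpace ℝ (Fin d)} (hy : ∀ i, y i = traj F x i + ε i)
    {O : Set (EuclideanSpace ℝ (Fin d))} (hO : ediam O < ENNReal.ofReal (Δ / 5))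
    {p q : ℕ} (hp : traj F x p ∈ O) (hq : traj F x q ∈ O) :
    ‖y p - y q‖ ≤ 3 * Δ / 5 := by
  have h1 : ‖traj F x p - traj F x q‖ ≤ Δ / 5 := by
    rw [← dist_eq_norm]
    have h := (edist_le_ediam_of_mem hp hq).trans hO.le
    rw [edist_dist] at h
    exact (ENNReal.ofReal_le_ofReal_iff (by positivity)).1 h
  have h2 : y p - y q = (traj F x p - traj F x q) + (ε p - ε q) := by
    rw [hy, hy]; abel
  rw [h2]
  linarith [norm_add_le (traj F x p - traj F x q) (ε p - ε q), norm_sub_le (ε p) (ε q),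
    hbdd p, hbdd q]

open scoped Classical in
/-- Every visit to the word `Os` seen by the window around `l` contributes an element of the
index set, except for visits near the right end. -/
theorem card_visits_le_card_Aset_add {F : Equiv.Perm Λ} {Δ : ℝ} (hΔ : 0 < Δ)
    {ε : ℕ → EuclideanSpace ℝ (Fin d)} (hbdd : ∀ i, ‖ε i‖ ≤ Δ / 5) {x : Λ}
    {y : ℕ → EuclideanSpace ℝ (Fin d)} (hy : ∀ i, y i = traj F x i + ε i) {k : ℕ}
    {Os : Fin (2 * k + 1) → Set (EuclideanSpace ℝ (Fin d))}
    (hO : ∀ t, ediam (Os t) < ENNReal.ofReal (Δ / 5)) {m : ℕ}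
    (hm : ∀ t : Fin (2 * k + 1), traj F x (m + (t : ℕ)) ∈ Os t) (n : ℕ) :
    ((Finset.range n).filter fun i : ℕ =>
      ∀ t : Fin (2 * k + 1), traj F x (i + (t : ℕ)) ∈ Os t).card ≤
      (Aset Δ y n (m + k) k).card + 2 * k := by
  set S := (Finset.range n).filter fun i : ℕ =>
    ∀ t : Fin (2 * k + 1), traj F x (i + (t : ℕ)) ∈ Os t with hS
  have hsub : (S \ Finset.Ico (n - 2 * k) n).map (addRightEmbedding k) ⊆
      Aset Δ y n (m + k) k := by
    intro j hj
    simp only [Finset.mem_map, Finset.mem_sdiff, hS, Finset.mem_filter, Finset.mem_range,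
      Finset.mem_Ico, addRightEmbedding_apply] at hj
    obtain ⟨i, ⟨⟨hin, hi⟩, hi'⟩, rfl⟩ := hj
    simp only [Aset, Finset.mem_filter, Finset.mem_Icc]
    refine ⟨by omega, fun s hs => ?_⟩
    have ht : (k + s).toNat < 2 * k + 1 := by omega
    have hi1 := hi ⟨_, ht⟩
    have hm1 := hm ⟨_, ht⟩
    have e1 : (((i + k : ℕ) : ℤ) + s).toNat = i + (k + s).toNat := by omega
    have e2 : (((m + k : ℕ) : ℤ) + s).toNat = m + (k + s).toNat := by omega
    rw [e1, e2]
    exact norm_observation_sub_le hΔ hbdd hy (hO ⟨_, ht⟩) (by exact_mod_cast hi1)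
      (by exact_mod_cast hm1)
  have h1 := Finset.card_le_card hsub
  rw [Finset.card_map] at h1
  have h2 := Finset.le_card_sdiff (Finset.Ico (n - 2 * k) n) S
  rw [Nat.card_Ico] at h2
  omega

theorem tendsto_log_natCast_atTop : Tendsto (fun n : ℕ => Real.log n) atTop atTop :=
  Real.tendsto_log_atTop.comp tendsto_natCast_atTop_atTop

theorem eventually_div_log_add_le {c : ℝ} (hc : 0 < c) (b : ℝ) :
    ∀ᶠ n : ℕ in atTop, (n : ℝ) / Real.log n + b ≤ c * n := by
  filter_upwards [tendsto_log_natCast_atTop.eventually_ge_atTop (2 / c),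
    tendsto_natCast_atTop_atTop.eventually_ge_atTop (2 * b / c)] with n h1 h2
  have hl : 0 < Real.log n := lt_of_lt_of_le (by positivity) h1
  have h3 : (n : ℝ) / Real.log n ≤ c / 2 * n := by
    rw [div_le_iff₀ hl]
    rw [div_le_iff₀ hc] at h1
    nlinarith [(Nat.cast_nonneg n : (0 : ℝ) ≤ n)]
  rw [div_le_iff₀ hc] at h2
  linarith

/-- A set of positive lower density has eventually more than `n / log n + b` elements
below `n`. -/
theorem eventually_div_log_add_le_card {P : ℕ → Prop} [DecidablePred P]
    (hP : 0 < Filter.liminf (fun n : ℕ => (n : ℝ)⁻¹ * ∑ i ∈ Finset.range n,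
      (if P i then (1 : ℝ) else 0)) atTop) (b : ℝ) :
    ∀ᶠ n : ℕ in atTop,
      (n : ℝ) / Real.log n + b ≤ (((Finset.range n).filter P).card : ℝ) := by
  obtain ⟨c, hc, hcl⟩ := exists_between hP
  have hbd : IsBoundedUnder (· ≥ ·) atTop (fun n : ℕ => (n : ℝ)⁻¹ * ∑ i ∈ Finset.range n,
      (if P i then (1 : ℝ) else 0)) :=
    isBoundedUnder_of ⟨0, fun n => mul_nonneg (by positivity)
      (Finset.sum_nonneg fun i _ => by split_ifs <;> norm_num)⟩
  filter_upwards [eventually_lt_of_lt_liminf hcl hbd, eventually_div_log_add_le hc b,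
    eventually_gt_atTop 0] with n h1 h2 hn
  refine h2.trans ?_
  rw [Finset.sum_boole, inv_mul_eq_div, lt_div_iff₀ (by exact_mod_cast hn)] at h1
  exact h1.le

open scoped Classical in
/-- A word that is visited finitely often or with positive lower density is followed by windows
with large index sets. -/
theorem eventually_div_log_le_card_Aset_of_word {F : Equiv.Perm Λ} {Δ : ℝ} (hΔ : 0 < Δ)
    {ε : ℕ → EuclideanSpace ℝ (Fin d)} (hbdd : ∀ i, ‖ε i‖ ≤ Δ / 5) {x : Λ}
    {y : ℕ → EuclideanSpace ℝ (Fin d)} (hy : ∀ i, y i = traj F x i + ε i) {k : ℕ}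
    {Os : Fin (2 * k + 1) → Set (EuclideanSpace ℝ (Fin d))}
    (hO : ∀ t, ediam (Os t) < ENNReal.ofReal (Δ / 5))
    (hrec : {i : ℕ | ∀ t : Fin (2 * k + 1), traj F x (i + (t : ℕ)) ∈ Os t}.Finite ∨
      0 < Filter.liminf (fun n : ℕ => (n : ℝ)⁻¹ * ∑ i ∈ Finset.range n,
        (if ∀ t : Fin (2 * k + 1), traj F x (i + (t : ℕ)) ∈ Os t then (1 : ℝ) else 0)) atTop) :
    ∀ᶠ n : ℕ in atTop, ∀ m : ℕ, Real.log n ≤ (m + k : ℕ) →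
      (∀ t : Fin (2 * k + 1), traj F x (m + (t : ℕ)) ∈ Os t) →
      (n : ℝ) / Real.log n ≤ ((Aset Δ y n (m + k) k).card : ℝ) := by
  rcases hrec with hfin | hpos
  · obtain ⟨B, hB⟩ := hfin.bddAbove
    filter_upwards [tendsto_log_natCast_atTop.eventually_gt_atTop ((B + k : ℕ) : ℝ)]
      with n hn m hm hmw
    have h1 : m ≤ B := hB hmw
    have h2 : B + k < m + k := by exact_mod_cast hn.trans_le hm
    omega
  · filter_upwards [eventually_div_log_add_le_card hpos ((2 * k : ℕ) : ℝ)] with n hn m _ hmw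
    have h := card_visits_le_card_Aset_add hΔ hbdd hy hO hmw n
    have h' := hn.trans (Nat.cast_le.2 h)
    rw [Nat.cast_add] at h'
    exact le_of_add_le_add_right h'

/-- Under strong recurrence, all the windows of a fixed width have large index sets. -/
theorem eventually_div_log_le_card_Aset {F : Equiv.Perm Λ} {Δ : ℝ} (hΔ : 0 < Δ)
    {ε : ℕ → EuclideanSpace ℝ (Fin d)} (hbdd : ∀ i, ‖ε i‖ ≤ Δ / 5) {x : Λ}
    (hx : StronglyRecurrent F Δ x)
    {y : ℕ → EuclideanSpace ℝ (Fin d)} (hy : ∀ i, y i = traj F x i + ε i) (k : ℕ) :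
    ∀ᶠ n : ℕ in atTop, ∀ j : ℕ, Real.log n ≤ j →
      (n : ℝ) / Real.log n ≤ ((Aset Δ y n j k).card : ℝ) := by
  obtain ⟨𝒪, hdiam, hcover, hrec⟩ := hx
  have hword : ∀ w : Fin (2 * k + 1) → 𝒪, ∀ᶠ n : ℕ in atTop, ∀ m : ℕ,
      Real.log n ≤ (m + k : ℕ) →
      (∀ t : Fin (2 * k + 1), traj F x (m + (t : ℕ)) ∈ (w t : Set _)) →
      (n : ℝ) / Real.log n ≤ ((Aset Δ y n (m + k) k).card : ℝ) := fun w =>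
    eventually_div_log_le_card_Aset_of_word hΔ hbdd hy (fun t => hdiam _ (w t).2)
      (hrec (2 * k + 1) (by omega) (fun t => w t) (fun t => (w t).2))
  filter_upwards [eventually_all.2 hword,
    tendsto_log_natCast_atTop.eventually_ge_atTop (k : ℝ)] with n hn hk j hj
  obtain ⟨m, rfl⟩ := Nat.exists_eq_add_of_le' (by exact_mod_cast hk.trans hj : k ≤ j)
  have hex : ∀ t : Fin (2 * k + 1), ∃ O : 𝒪, traj F x (m + (t : ℕ)) ∈ (O : Set _) := by
    intro t
    obtain ⟨O, hO, hmem⟩ := mem_iUnion₂.1 (hcover ((F ^ ((m : ℤ) + (t : ℕ))) x).2)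
    exact ⟨⟨O, hO⟩, hmem⟩
  choose w hw using hex
  exact hn w m hj hw

/-- If the initial state is strongly recurrent, then
`min{ k_{j,n} : log n ≤ j ≤ n - log n } → ∞`. -/
theorem stmt_12 (hΛ : IsCompact Λ) (F : Equiv.Perm Λ) (Δ : ℝ) (hΔ : 0 < Δ)
    (hexp : Expansive F Δ)
    (ε : ℕ → EuclideanSpace ℝ (Fin d)) (hbdd : ∀ i, ‖ε i‖ ≤ Δ / 5)
    (x : Λ) (hx : StronglyRecurrent F Δ x)
    (y : ℕ → EuclideanSpace ℝ (Fin d)) (hy : ∀ i, y i = traj F x i + ε i) :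
    Tendsto
      (fun n : ℕ => sInf {v : ℕ | ∃ j : ℕ, Real.log n ≤ (j : ℝ) ∧
        (j : ℝ) ≤ (n : ℝ) - Real.log n ∧ v = kvar Δ y n j})
      atTop atTop := by
  rw [Filter.tendsto_atTop]
  intro b
  have hlog : ∀ᶠ n : ℕ in atTop, 2 * Real.log n + 1 ≤ n := by
    filter_upwards [tendsto_natCast_atTop_atTop.eventually
      (Real.isLittleO_log_id_atTop.bound (by norm_num : (0 : ℝ) < 1 / 4)),
      eventually_ge_atTop 2] with n h1 h2
    have h2' : (2 : ℝ) ≤ n := by exact_mod_cast h2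
    have h3 := (le_abs_self _).trans h1
    simp only [id, Real.norm_eq_abs, abs_of_nonneg (by linarith : (0 : ℝ) ≤ n)] at h3
    linarith
  filter_upwards [eventually_div_log_le_card_Aset hΔ hbdd hx hy (b + 1),
    tendsto_log_natCast_atTop.eventually_ge_atTop ((b + 1 : ℕ) : ℝ), hlog] with n hn hb hl
  refine le_csInf ⟨_, ⌈Real.log n⌉₊, Nat.le_ceil _, ?_, rfl⟩ ?_
  · linarith [Nat.ceil_lt_add_one (Real.log_natCast_nonneg n)]
  · rintro _ ⟨j, hj, -, rfl⟩
    refine b.le_succ.trans (le_csSup ⟨⌊Real.log n⌋₊, ?_⟩ ⟨by omega, hb, hn j hj⟩)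
    exact fun k hk => Nat.le_floor hk.2.1

end
end

section
/- Let F be expansive with separation threshold Δ > 0 and finite separation horizon, and suppose |ε_i| ≤ Δ/5 for all i. Then for any k ≤ l ≤ n − k: every j ∈ A_n(l,k) satisfies |x_l − x_j| ≤ H^{-1}(k), and consequently |x_l − x̂_{l,n}| ≤ H^{-1}(k) + |Σ_{j ∈ A_n(l,k)} ε_j| / |A_n(l,k)|. -/
open MeasureTheory Filter Set Metric
open scoped ENNReal

noncomputable section

variable {d : ℕ} {Λ : Set (EuclideanSpace ℝ (Fin d))}

lemma traj_traj (F : Equiv.Perm Λ) (x : Λ) (a s : ℤ) :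
    traj F ((F ^ a) x) s = traj F x (a + s) := by
  simp only [traj]
  rw [add_comm, zpow_add, Equiv.Perm.mul_apply]

lemma lt_sepTime {F : Equiv.Perm Λ} {Δ : ℝ} (hexp : Expansive F Δ) {x x' : Λ} (hne : x ≠ x')
    {k : ℕ} (h : ∀ s : ℤ, s.natAbs ≤ k → ‖traj F x s - traj F x' s‖ ≤ Δ) :
    k < sepTime F Δ x x' := by
  obtain ⟨s, hs⟩ := hexp x x' hne
  obtain ⟨t, ht, hlt⟩ := Nat.sInf_mem
    (s := {m : ℕ | ∃ s : ℤ, s.natAbs = m ∧ Δ < ‖traj F x s - traj F x' s‖}) ⟨_, s, rfl, hs⟩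
  by_contra! hle
  exact (h t (ht.trans_le hle)).not_gt hlt

lemma sepTime_le_sepHorizon (F : Equiv.Perm Λ) (Δ : ℝ) {α : ℝ} {x x' : Λ}
    (h : α ≤ ‖(x : EuclideanSpace ℝ (Fin d)) - (x' : EuclideanSpace ℝ (Fin d))‖) :
    (sepTime F Δ x x' : ℕ∞) ≤ sepHorizon F Δ α :=
  le_iSup₂_of_le (x, x') h le_rfl

lemma exists_sepHorizon_eq_zero (hΛ : Bornology.IsBounded Λ) (F : Equiv.Perm Λ) (Δ : ℝ) :
    ∃ α : ℝ, 0 < α ∧ sepHorizon F Δ α = 0 := by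
  refine ⟨diam Λ + 1, by linarith [diam_nonneg (s := Λ)], nonpos_iff_eq_zero.1 ?_⟩
  refine iSup₂_le fun p hp => ?_
  have := dist_le_diam_of_mem hΛ p.1.2 p.2.2
  rw [dist_eq_norm] at this
  linarith

/-- Points whose orbits stay within `Δ` over the window `|s| ≤ k` are `H⁻¹(k)`-close. -/
lemma norm_sub_le_sepHorizonInv (hΛ : Bornology.IsBounded Λ) {F : Equiv.Perm Λ} {Δ : ℝ}
    (hexp : Expansive F Δ) {x x' : Λ} {k : ℕ}
    (h : ∀ s : ℤ, s.natAbs ≤ k → ‖traj F x s - traj F x' s‖ ≤ Δ) :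
    ‖(x : EuclideanSpace ℝ (Fin d)) - (x' : EuclideanSpace ℝ (Fin d))‖
      ≤ sepHorizonInv F Δ k := by
  obtain ⟨β, hβ, hβ0⟩ := exists_sepHorizon_eq_zero hΛ F Δ
  refine le_csInf ⟨β, hβ, by simp [hβ0]⟩ ?_
  rintro α ⟨hα, hk⟩
  by_contra! hlt
  have hne : x ≠ x' := by
    rintro rfl
    simp only [sub_self, norm_zero] at hlt
    linarith
  have hle := (sepTime_le_sepHorizon F Δ hlt.le).trans hk
  exact (lt_sepTime hexp hne h).not_ge (by exact_mod_cast hle)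

lemma norm_sub_inv_card_smul_sum_le {E ι : Type*} [NormedAddCommGroup E] [NormedSpace ℝ E]
    {A : Finset ι} (hA : A.Nonempty) (a : E) (u e : ι → E) {c : ℝ}
    (h : ∀ j ∈ A, ‖a - u j‖ ≤ c) :
    ‖a - (A.card : ℝ)⁻¹ • ∑ j ∈ A, (u j + e j)‖ ≤ c + ‖∑ j ∈ A, e j‖ / (A.card : ℝ) := by
  have hpos : (0 : ℝ) < A.card := by exact_mod_cast hA.card_pos
  have key : a - (A.card : ℝ)⁻¹ • ∑ j ∈ A, (u j + e j)
      = (A.card : ℝ)⁻¹ • ∑ j ∈ A, (a - u j) - (A.card : ℝ)⁻¹ • ∑ j ∈ A, e j := by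
    rw [Finset.sum_add_distrib, Finset.sum_sub_distrib, Finset.sum_const, smul_add, smul_sub,
      ← Nat.cast_smul_eq_nsmul ℝ, inv_smul_smul₀ hpos.ne']
    abel
  rw [key]
  refine (norm_sub_le _ _).trans (add_le_add ?_ ?_)
  · rw [norm_smul, norm_inv, Real.norm_of_nonneg hpos.le, inv_mul_le_iff₀ hpos, ← nsmul_eq_mul]
    exact norm_sum_le_of_le _ h |>.trans_eq (by simp)
  · rw [norm_smul, norm_inv, Real.norm_of_nonneg hpos.le, div_eq_inv_mul]

lemma self_mem_Aset {Δ : ℝ} (hΔ : 0 ≤ Δ) (y : ℕ → EuclideanSpace ℝ (Fin d)) {n l k : ℕ}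
    (hlk : k ≤ l) (hln : l ≤ n - k) : l ∈ Aset Δ y n l k := by
  simp only [Aset, Finset.mem_filter, Finset.mem_Icc, sub_self, norm_zero]
  exact ⟨⟨hlk, hln⟩, fun _ _ => by positivity⟩

lemma norm_traj_sub_traj_le_of_mem_Aset {F : Equiv.Perm Λ} {Δ : ℝ}
    {ε : ℕ → EuclideanSpace ℝ (Fin d)} (hbdd : ∀ i, ‖ε i‖ ≤ Δ / 5) {x : Λ}
    {y : ℕ → EuclideanSpace ℝ (Fin d)} (hy : ∀ i, y i = traj F x i + ε i)
    {n l k j : ℕ} (hlk : k ≤ l) (hj : j ∈ Aset Δ y n l k) {s : ℤ} (hs : s.natAbs ≤ k) :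
    ‖traj F x (l + s) - traj F x (j + s)‖ ≤ Δ := by
  simp only [Aset, Finset.mem_filter, Finset.mem_Icc] at hj
  obtain ⟨⟨hkj, -⟩, hA⟩ := hj
  have hd := hA s ⟨by omega, by omega⟩
  obtain ⟨p, hp⟩ := Int.eq_ofNat_of_zero_le (show 0 ≤ (j : ℤ) + s by omega)
  obtain ⟨q, hq⟩ := Int.eq_ofNat_of_zero_le (show 0 ≤ (l : ℤ) + s by omega)
  rw [hp, hq] at hd ⊢
  rw [Int.toNat_natCast, Int.toNat_natCast] at hd
  have key : traj F x q - traj F x p = (ε p - ε q) - (y p - y q) := by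
    rw [hy p, hy q]
    abel
  rw [key]
  linarith [norm_sub_le (ε p - ε q) (y p - y q), norm_sub_le (ε p) (ε q), hbdd p, hbdd q]

/-- Bias bound: every `j ∈ A_n(l,k)` satisfies `|x_l - x_j| ≤ H⁻¹(k)`,
and hence `|x_l - x̂_{l,n}| ≤ H⁻¹(k) + |Σ_{j ∈ A_n(l,k)} ε_j| / |A_n(l,k)|`. -/
theorem stmt_16 (hΛ : IsCompact Λ) (F : Equiv.Perm Λ) (Δ : ℝ) (hΔ : 0 < Δ)
    (hexp : Expansive F Δ) (hfin : FiniteSepHorizon F Δ)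
    (ε : ℕ → EuclideanSpace ℝ (Fin d)) (hbdd : ∀ i, ‖ε i‖ ≤ Δ / 5)
    (x : Λ) (y : ℕ → EuclideanSpace ℝ (Fin d))
    (hy : ∀ i, y i = traj F x i + ε i)
    (n l k : ℕ) (hlk : k ≤ l) (hln : l ≤ n - k) :
    (∀ j ∈ Aset Δ y n l k, ‖traj F x l - traj F x j‖ ≤ sepHorizonInv F Δ k) ∧
      ‖traj F x l - xhat Δ y n l k‖ ≤
        sepHorizonInv F Δ k +
          ‖∑ j ∈ Aset Δ y n l k, ε j‖ / ((Aset Δ y n l k).card : ℝ) := by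
  have hclose : ∀ j ∈ Aset Δ y n l k,
      ‖traj F x l - traj F x j‖ ≤ sepHorizonInv F Δ k := fun j hj =>
    norm_sub_le_sepHorizonInv hΛ.isBounded hexp fun s hs => by
      simpa only [traj_traj] using norm_traj_sub_traj_le_of_mem_Aset hbdd hy hlk hj hs
  refine ⟨hclose, ?_⟩
  rw [xhat, Finset.sum_congr rfl fun j _ => hy j]
  exact norm_sub_inv_card_smul_sum_le ⟨l, self_mem_Aset hΔ.le y hlk hln⟩ _ _ _ hclose

end
end
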